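/- arXiv:2404.00293 — 2 statements merged into one kernel-verified Lean document; each statement's English description precedes it below -/
import Mathlib

section
/- Let (x, y) ∈ ℝⁿ × ℝᵐ with x ≠ 0. Then the Grushin Kaplan norm N satisfies |∇_γ N(x, y)|² = |x|^{2γ}/N(x, y)^{2γ}, i.e. |∇_x N(x, y)|² + |x|^{2γ}|∇_y N(x, y)|² = |x|^{2γ}/N(x, y)^{2γ}. -/
/-- The Grushin Kaplan norm `N(x,y) = (|x|^{2(1+γ)} + (1+γ)²|y|²)^{1/(2+2γ)}` on `ℝⁿ × ℝᵐ`. -/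
noncomputable def GKaplan (n m : ℕ) (γ : ℝ)
    (w : EuclideanSpace ℝ (Fin n) × EuclideanSpace ℝ (Fin m)) : ℝ :=
  (‖w.1‖ ^ (2 * (1 + γ)) + (1 + γ) ^ 2 * ‖w.2‖ ^ 2) ^ (1 / (2 + 2 * γ))

/-- Partial derivative `∂_{x_i} f` in the `i`-th coordinate of the `x`-variable. -/
noncomputable def dX (n m : ℕ)
    (f : EuclideanSpace ℝ (Fin n) × EuclideanSpace ℝ (Fin m) → ℝ)
    (w : EuclideanSpace ℝ (Fin n) × EuclideanSpace ℝ (Fin m)) (i : Fin n) : ℝ :=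
  fderiv ℝ f w (EuclideanSpace.single i (1 : ℝ), 0)

/-- Partial derivative `∂_{y_j} f` in the `j`-th coordinate of the `y`-variable. -/
noncomputable def dY (n m : ℕ)
    (f : EuclideanSpace ℝ (Fin n) × EuclideanSpace ℝ (Fin m) → ℝ)
    (w : EuclideanSpace ℝ (Fin n) × EuclideanSpace ℝ (Fin m)) (j : Fin m) : ℝ :=
  fderiv ℝ f w (0, EuclideanSpace.single j (1 : ℝ))

/-- The derivative of the Grushin Kaplan norm away from `x = 0`. -/
theorem GKaplan.hasFDerivAt (n m : ℕ) {γ : ℝ} (hγ : 0 ≤ γ)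
    (w : EuclideanSpace ℝ (Fin n) × EuclideanSpace ℝ (Fin m)) (hx : w.1 ≠ 0) :
    HasFDerivAt (GKaplan n m γ)
      ((‖w.1‖ ^ (2 * (1 + γ)) + (1 + γ) ^ 2 * ‖w.2‖ ^ 2) ^ (1 / (2 + 2 * γ) - 1) •
        (‖w.1‖ ^ (2 * γ) • (innerSL ℝ w.1).comp (ContinuousLinearMap.fst ℝ _ _) +
          (1 + γ) • (innerSL ℝ w.2).comp (ContinuousLinearMap.snd ℝ _ _))) w := by
  have hr : 0 < ‖w.1‖ := norm_pos_iff.mpr hx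
  have hS : 0 < ‖w.1‖ ^ (2 * (1 + γ)) + (1 + γ) ^ 2 * ‖w.2‖ ^ 2 := by positivity
  have h1 := (hasFDerivAt_norm_rpow w.1 (p := 2 * (1 + γ)) (by linarith)).comp w hasFDerivAt_fst
  have h2 := ((hasStrictFDerivAt_norm_sq w.2).hasFDerivAt.comp w hasFDerivAt_snd).const_mul
    ((1 + γ) ^ 2)
  have h3 := (h1.add h2).rpow_const (p := 1 / (2 + 2 * γ)) (Or.inl hS.ne')
  refine h3.congr_fderiv ?_
  have hp : (2 : ℝ) + 2 * γ ≠ 0 := by positivity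
  have he : 2 * (1 + γ) - 2 = 2 * γ := by ring
  ext v <;> simp [he] <;> field_simp

/-- Eikonal-type identity `|∇_γ N|² = |x|^{2γ}/N^{2γ}` for the Grushin Kaplan norm. -/
theorem grushin_kaplan_eikonal (n m : ℕ) (hn : 1 ≤ n) (hm : 1 ≤ m) (γ : ℝ) (hγ : 0 ≤ γ)
    (w : EuclideanSpace ℝ (Fin n) × EuclideanSpace ℝ (Fin m)) (hx : w.1 ≠ 0) :
    (∑ i, (dX n m (GKaplan n m γ) w i) ^ 2) +
      ‖w.1‖ ^ (2 * γ) * ∑ j, (dY n m (GKaplan n m γ) w j) ^ 2 =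
      ‖w.1‖ ^ (2 * γ) / (GKaplan n m γ w) ^ (2 * γ) := by
  have hr : 0 < ‖w.1‖ := norm_pos_iff.mpr hx
  have hS : 0 < ‖w.1‖ ^ (2 * (1 + γ)) + (1 + γ) ^ 2 * ‖w.2‖ ^ 2 := by positivity
  have hp : (2 : ℝ) + 2 * γ ≠ 0 := by positivity
  have hX : ∀ i, dX n m (GKaplan n m γ) w i =
      (‖w.1‖ ^ (2 * (1 + γ)) + (1 + γ) ^ 2 * ‖w.2‖ ^ 2) ^ (1 / (2 + 2 * γ) - 1) *
        (‖w.1‖ ^ (2 * γ) * w.1 i) := fun i => by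
    simp [dX, (GKaplan.hasFDerivAt n m hγ w hx).fderiv, EuclideanSpace.inner_single_right]
  have hY : ∀ j, dY n m (GKaplan n m γ) w j =
      (‖w.1‖ ^ (2 * (1 + γ)) + (1 + γ) ^ 2 * ‖w.2‖ ^ 2) ^ (1 / (2 + 2 * γ) - 1) *
        ((1 + γ) * w.2 j) := fun j => by
    simp [dY, (GKaplan.hasFDerivAt n m hγ w hx).fderiv, EuclideanSpace.inner_single_right]
  have hN : (GKaplan n m γ w) ^ (2 * γ) *
      (((‖w.1‖ ^ (2 * (1 + γ)) + (1 + γ) ^ 2 * ‖w.2‖ ^ 2) ^ (1 / (2 + 2 * γ) - 1)) ^ 2 *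
        (‖w.1‖ ^ (2 * (1 + γ)) + (1 + γ) ^ 2 * ‖w.2‖ ^ 2)) = 1 := by
    unfold GKaplan
    generalize ‖w.1‖ ^ (2 * (1 + γ)) + (1 + γ) ^ 2 * ‖w.2‖ ^ 2 = S at hS ⊢
    rw [← Real.rpow_mul hS.le, ← Real.rpow_mul_natCast hS.le]
    nth_rw 3 [← Real.rpow_one S]
    rw [← Real.rpow_add hS, ← Real.rpow_add hS, ← Real.rpow_zero S]
    congr 1
    push_cast
    field_simp
    ring
  have hN0 : 0 < (GKaplan n m γ w) ^ (2 * γ) :=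
    Real.rpow_pos_of_pos (Real.rpow_pos_of_pos hS _) _
  have hxp : ‖w.1‖ ^ (2 * (1 + γ)) = ‖w.1‖ ^ (2 * γ) * ‖w.1‖ ^ 2 := by
    rw [← Real.rpow_natCast, ← Real.rpow_add hr]
    congr 1
    push_cast
    ring
  simp only [hX, hY, mul_pow, ← Finset.mul_sum, ← EuclideanSpace.real_norm_sq_eq]
  rw [eq_div_iff hN0.ne']
  generalize (‖w.1‖ ^ (2 * (1 + γ)) + (1 + γ) ^ 2 * ‖w.2‖ ^ 2) ^ (1 / (2 + 2 * γ) - 1) = T at hN ⊢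
  rw [hxp] at hN
  linear_combination ‖w.1‖ ^ (2 * γ) * hN
end

section
/- Let p > 2. There exists a constant C > 0 such that for every smooth compactly supported f: ℝ³ → ℝ, ∫ |x|² N^{2(p−2)} f² dμ ≤ C ( ∫ |∇_ℍ f|² dμ + ∫ f² dμ ). -/
open MeasureTheory

/-- Horizontal vector field `X₁ = ∂_{x₁} - (x₂/2) ∂_t` on the Heisenberg group `ℝ³`. -/
noncomputable def X1 (f : ℝ × ℝ × ℝ → ℝ) (w : ℝ × ℝ × ℝ) : ℝ :=
  fderiv ℝ f w (1, 0, -(w.2.1) / 2)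

/-- Horizontal vector field `X₂ = ∂_{x₂} + (x₁/2) ∂_t` on the Heisenberg group `ℝ³`. -/
noncomputable def X2 (f : ℝ × ℝ × ℝ → ℝ) (w : ℝ × ℝ × ℝ) : ℝ :=
  fderiv ℝ f w (0, 1, w.1 / 2)

/-- The Kaplan norm `N(x₁,x₂,t) = ((x₁² + x₂²)² + 16 t²)^{1/4}` on the Heisenberg group. -/
noncomputable def KaplanH (w : ℝ × ℝ × ℝ) : ℝ :=
  ((w.1 ^ 2 + w.2.1 ^ 2) ^ 2 + 16 * w.2.2 ^ 2) ^ ((1 : ℝ) / 4)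

/-- The probability measure `dμ = Z⁻¹ e^{-N^p} dξ` on the Heisenberg group `ℝ³`. -/
noncomputable def muH (p : ℝ) : Measure (ℝ × ℝ × ℝ) :=
  volume.withDensity (fun w => ENNReal.ofReal
    ((∫ v : ℝ × ℝ × ℝ, Real.exp (-(KaplanH v) ^ p))⁻¹ * Real.exp (-(KaplanH w) ^ p)))

/-- The squared Euclidean length `|x|²` of the horizontal part. -/
def horizSq (w : ℝ × ℝ × ℝ) : ℝ := w.1 ^ 2 + w.2.1 ^ 2

/-- The fourth power `N⁴ = |x|⁴ + 16 t²` of the Kaplan norm. -/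
def kaplanFour (w : ℝ × ℝ × ℝ) : ℝ := (w.1 ^ 2 + w.2.1 ^ 2) ^ 2 + 16 * w.2.2 ^ 2

/-- The derivative `X₁ N⁴`. -/
def kaplanFourX1 (w : ℝ × ℝ × ℝ) : ℝ := 4 * horizSq w * w.1 - 16 * w.2.2 * w.2.1

/-- The derivative `X₂ N⁴`. -/
def kaplanFourX2 (w : ℝ × ℝ × ℝ) : ℝ := 4 * horizSq w * w.2.1 + 16 * w.2.2 * w.1

/-- For `E = Xᵢ N⁴`, the derivative `Xᵢ U` of `U = (N⁴)^q`. -/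
noncomputable def potentialDeriv (q : ℝ) (E : ℝ × ℝ × ℝ → ℝ) (w : ℝ × ℝ × ℝ) : ℝ :=
  q * kaplanFour w ^ (q - 1) * E w

/-- For `E = Xᵢ N⁴`, the second derivative `Xᵢ Xᵢ U` of `U = (N⁴)^q`. -/
noncomputable def potentialDerivTwo (q : ℝ) (E : ℝ × ℝ × ℝ → ℝ) (w : ℝ × ℝ × ℝ) : ℝ :=
  q * kaplanFour w ^ (q - 1) * (12 * horizSq w) +
    q * (q - 1) * kaplanFour w ^ (q - 2) * E w ^ 2

/-- The component `f² e^{-U} Xᵢ U` of the horizontal flux. -/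
noncomputable def flux (q : ℝ) (f E : ℝ × ℝ × ℝ → ℝ) (w : ℝ × ℝ × ℝ) : ℝ :=
  f w ^ 2 * Real.exp (-kaplanFour w ^ q) * potentialDeriv q E w

/-- The derivative `Xᵢ (f² e^{-U} Xᵢ U)`, where `g = Xᵢ f`. -/
noncomputable def fluxDeriv (q : ℝ) (f g E : ℝ × ℝ × ℝ → ℝ) (w : ℝ × ℝ × ℝ) : ℝ :=
  Real.exp (-kaplanFour w ^ q) * (2 * f w * g w * potentialDeriv q E w -
    f w ^ 2 * potentialDeriv q E w ^ 2 + f w ^ 2 * potentialDerivTwo q E w)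

lemma horizSq_nonneg (w : ℝ × ℝ × ℝ) : 0 ≤ horizSq w := by
  unfold horizSq; positivity

lemma kaplanFour_nonneg (w : ℝ × ℝ × ℝ) : 0 ≤ kaplanFour w := by
  unfold kaplanFour; positivity

lemma horizSq_sq_le (w : ℝ × ℝ × ℝ) : horizSq w ^ 2 ≤ kaplanFour w := by
  unfold kaplanFour horizSq; nlinarith [sq_nonneg w.2.2]

lemma horizSq_eq_zero {w : ℝ × ℝ × ℝ} (h : kaplanFour w = 0) : horizSq w = 0 :=
  (pow_eq_zero_iff two_ne_zero).1 (le_antisymm (h ▸ horizSq_sq_le w) (sq_nonneg _))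

lemma kaplanFourX1_sq_add_X2_sq (w : ℝ × ℝ × ℝ) :
    kaplanFourX1 w ^ 2 + kaplanFourX2 w ^ 2 = 16 * horizSq w * kaplanFour w := by
  unfold kaplanFourX1 kaplanFourX2 kaplanFour horizSq; ring

lemma continuous_horizSq : Continuous horizSq := by unfold horizSq; fun_prop

lemma continuous_kaplanFour : Continuous kaplanFour := by unfold kaplanFour; fun_prop

lemma continuous_kaplanFourX1 : Continuous kaplanFourX1 := by
  unfold kaplanFourX1 horizSq; fun_prop

lemma continuous_kaplanFourX2 : Continuous kaplanFourX2 := by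
  unfold kaplanFourX2 horizSq; fun_prop

lemma kaplanH_rpow (w : ℝ × ℝ × ℝ) (s : ℝ) : KaplanH w ^ s = kaplanFour w ^ (s / 4) := by
  rw [KaplanH, ← kaplanFour, ← Real.rpow_mul (kaplanFour_nonneg w)]
  congr 1; ring

lemma horizSq_mul_rpow_le (q : ℝ) (w : ℝ × ℝ × ℝ) :
    horizSq w * kaplanFour w ^ (q - 1) ≤ kaplanFour w ^ (q - 1 / 2) := by
  rcases (kaplanFour_nonneg w).eq_or_lt with h | h
  · rw [horizSq_eq_zero h.symm, zero_mul]
    exact Real.rpow_nonneg (kaplanFour_nonneg w) _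
  · have h1 : horizSq w ≤ kaplanFour w ^ (1 / 2 : ℝ) := by
      rw [← Real.sqrt_eq_rpow]
      exact Real.le_sqrt_of_sq_le (horizSq_sq_le w)
    calc horizSq w * kaplanFour w ^ (q - 1)
        ≤ kaplanFour w ^ (1 / 2 : ℝ) * kaplanFour w ^ (q - 1) := by gcongr
      _ = kaplanFour w ^ (q - 1 / 2) := by
        rw [← Real.rpow_add h]; congr 1; ring

lemma horizSq_mul_rpow_sq (q : ℝ) (w : ℝ × ℝ × ℝ) :
    horizSq w * kaplanFour w * (kaplanFour w ^ (q - 1)) ^ 2 =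
      horizSq w * kaplanFour w ^ (2 * q - 1) := by
  rcases (kaplanFour_nonneg w).eq_or_lt with h | h
  · simp [horizSq_eq_zero h.symm]
  · have : kaplanFour w ^ (2 * q - 1) = kaplanFour w * (kaplanFour w ^ (q - 1)) ^ 2 := by
      rw [show 2 * q - 1 = 1 + (q - 1) + (q - 1) by ring, Real.rpow_add h, Real.rpow_add h,
        Real.rpow_one]
      ring
    rw [this]; ring

lemma horizSq_mul_rpow_sub_two (q : ℝ) (w : ℝ × ℝ × ℝ) :
    horizSq w * kaplanFour w * kaplanFour w ^ (q - 2) =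
      horizSq w * kaplanFour w ^ (q - 1) := by
  rcases (kaplanFour_nonneg w).eq_or_lt with h | h
  · simp [horizSq_eq_zero h.symm]
  · rw [show q - 1 = 1 + (q - 2) by ring, Real.rpow_add h, Real.rpow_one]; ring

lemma potentialDeriv_sq_add (q : ℝ) (w : ℝ × ℝ × ℝ) :
    potentialDeriv q kaplanFourX1 w ^ 2 + potentialDeriv q kaplanFourX2 w ^ 2 =
      16 * q ^ 2 * (horizSq w * kaplanFour w ^ (2 * q - 1)) := by
  rw [← horizSq_mul_rpow_sq]
  unfold potentialDeriv
  linear_combination q ^ 2 * (kaplanFour w ^ (q - 1)) ^ 2 * kaplanFourX1_sq_add_X2_sq w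

lemma potentialDerivTwo_add (q : ℝ) (w : ℝ × ℝ × ℝ) :
    potentialDerivTwo q kaplanFourX1 w + potentialDerivTwo q kaplanFourX2 w =
      8 * q * (2 * q + 1) * (horizSq w * kaplanFour w ^ (q - 1)) := by
  unfold potentialDerivTwo
  linear_combination q * (q - 1) * kaplanFour w ^ (q - 2) * kaplanFourX1_sq_add_X2_sq w +
    16 * q * (q - 1) * horizSq_mul_rpow_sub_two q w

lemma potentialDeriv_sq_le (q : ℝ) {E : ℝ × ℝ × ℝ → ℝ} {w : ℝ × ℝ × ℝ}
    (hE : E w ^ 2 ≤ 16 * horizSq w * kaplanFour w) :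
    potentialDeriv q E w ^ 2 ≤ 16 * q ^ 2 * (horizSq w * kaplanFour w ^ (2 * q - 1)) := by
  rw [← horizSq_mul_rpow_sq]
  unfold potentialDeriv
  nlinarith [mul_le_mul_of_nonneg_left hE (sq_nonneg (q * kaplanFour w ^ (q - 1)))]

lemma abs_potentialDerivTwo_le {q : ℝ} (hq : 0 ≤ q) {E : ℝ × ℝ × ℝ → ℝ} {w : ℝ × ℝ × ℝ}
    (hE : E w ^ 2 ≤ 16 * horizSq w * kaplanFour w) :
    |potentialDerivTwo q E w| ≤ (12 * q + 16 * q * |q - 1|) * kaplanFour w ^ (q - 1 / 2) := by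
  have hr := horizSq_nonneg w
  have hA : 0 ≤ kaplanFour w ^ (q - 1) := Real.rpow_nonneg (kaplanFour_nonneg w) _
  have hB : 0 ≤ kaplanFour w ^ (q - 2) := Real.rpow_nonneg (kaplanFour_nonneg w) _
  have hEB : kaplanFour w ^ (q - 2) * E w ^ 2 ≤ 16 * (horizSq w * kaplanFour w ^ (q - 1)) := by
    rw [← horizSq_mul_rpow_sub_two]
    nlinarith [mul_le_mul_of_nonneg_left hE hB]
  calc |potentialDerivTwo q E w|
      ≤ |q * kaplanFour w ^ (q - 1) * (12 * horizSq w)| +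
        |q * (q - 1) * kaplanFour w ^ (q - 2) * E w ^ 2| := abs_add_le _ _
    _ = 12 * q * (horizSq w * kaplanFour w ^ (q - 1)) +
        q * |q - 1| * (kaplanFour w ^ (q - 2) * E w ^ 2) := by
      rw [abs_of_nonneg (by positivity), abs_mul, abs_mul, abs_mul, abs_of_nonneg hq,
        abs_of_nonneg hB, abs_of_nonneg (sq_nonneg (E w))]
      ring
    _ ≤ 12 * q * (horizSq w * kaplanFour w ^ (q - 1)) +
        q * |q - 1| * (16 * (horizSq w * kaplanFour w ^ (q - 1))) := by gcongr
    _ = (12 * q + 16 * q * |q - 1|) * (horizSq w * kaplanFour w ^ (q - 1)) := by ring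
    _ ≤ _ := by gcongr; exact horizSq_mul_rpow_le q w

/-- `ΔU ≤ |∇U|² / 4 + K` for `U = (N⁴)^q`. -/
lemma exists_laplacian_le {q : ℝ} (hq : 1 / 2 < q) :
    ∃ K ≥ 0, ∀ w, 8 * q * (2 * q + 1) * (horizSq w * kaplanFour w ^ (q - 1)) ≤
      4 * q ^ 2 * (horizSq w * kaplanFour w ^ (2 * q - 1)) + K := by
  have hq0 : 0 < q := by linarith
  set L : ℝ := 2 * (2 * q + 1) / q with hL
  have hLq : L * q = 2 * (2 * q + 1) := by rw [hL]; field_simp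
  have hL0 : 0 ≤ L := by positivity
  refine ⟨8 * q * (2 * q + 1) * L ^ ((q - 1 / 2) / q), by positivity, fun w => ?_⟩
  have hD := kaplanFour_nonneg w
  have hr := horizSq_nonneg w
  have hA : 0 ≤ kaplanFour w ^ (q - 1) := Real.rpow_nonneg hD _
  rcases le_total L (kaplanFour w ^ q) with h | h
  · have hW : horizSq w * kaplanFour w ^ (2 * q - 1) =
        horizSq w * kaplanFour w ^ (q - 1) * kaplanFour w ^ q := by
      rw [show 2 * q - 1 = (q - 1) + q by ring,
        Real.rpow_add' hD (by linarith), mul_assoc]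
    rw [hW]
    have h1 : horizSq w * kaplanFour w ^ (q - 1) * L ≤
        horizSq w * kaplanFour w ^ (q - 1) * kaplanFour w ^ q := by gcongr
    have h2 : 0 ≤ 8 * q * (2 * q + 1) * L ^ ((q - 1 / 2) / q) := by positivity
    have h3 := mul_le_mul_of_nonneg_left h1 (show 0 ≤ 4 * q ^ 2 by positivity)
    have h4 : 4 * q ^ 2 * (horizSq w * kaplanFour w ^ (q - 1) * L) =
        8 * q * (2 * q + 1) * (horizSq w * kaplanFour w ^ (q - 1)) := by
      linear_combination 4 * q * (horizSq w * kaplanFour w ^ (q - 1)) * hLq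
    linarith
  · have h1 : kaplanFour w ^ (q - 1 / 2) ≤ L ^ ((q - 1 / 2) / q) := by
      have : kaplanFour w ^ (q - 1 / 2) = (kaplanFour w ^ q) ^ ((q - 1 / 2) / q) := by
        rw [← Real.rpow_mul hD]; congr 1; field_simp
      rw [this]
      exact Real.rpow_le_rpow (Real.rpow_nonneg hD _) h
        (div_nonneg (by linarith) hq0.le)
    have h2 : 0 ≤ 4 * q ^ 2 * (horizSq w * kaplanFour w ^ (2 * q - 1)) :=
      mul_nonneg (by positivity) (mul_nonneg hr (Real.rpow_nonneg hD _))
    have h3 := mul_le_mul_of_nonneg_left ((horizSq_mul_rpow_le q w).trans h1)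
      (show 0 ≤ 8 * q * (2 * q + 1) by positivity)
    linarith

lemma measurePreserving_shear (c : ℝ) :
    MeasurePreserving (fun w : ℝ × ℝ × ℝ => (w.1, w.2.1, w.2.2 + c * w.1 * w.2.1)) := by
  refine (MeasurePreserving.id (volume : Measure ℝ)).skew_product
    (g := fun (a : ℝ) (y : ℝ × ℝ) => (y.1, y.2 + c * a * y.1)) ?_ (.of_forall fun a => ?_)
  · fun_prop
  · exact ((MeasurePreserving.id (volume : Measure ℝ)).skew_product
      (g := fun (b s : ℝ) => s + c * a * b) (by fun_prop)
      (.of_forall fun b => (measurePreserving_add_right volume (c * a * b)).map_eq)).map_eq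

lemma integral_eq_zero_of_hasDerivAt_X1 {F F' : ℝ × ℝ × ℝ → ℝ} (hF : Integrable F)
    (hF' : Integrable F')
    (h : ∀ b ≠ 0, ∀ s a : ℝ, HasDerivAt (fun a => F (a, b, s + -1 / 2 * a * b))
      (F' (a, b, s + -1 / 2 * a * b)) a) :
    ∫ w, F' w = 0 := by
  have hT := measurePreserving_shear (-1 / 2)
  have hm := hF'.1
  rw [← hT.map_eq] at hm
  have hG := hT.integrable_comp_of_integrable hF
  have hG' := hT.integrable_comp_of_integrable hF'
  rw [← hT.map_eq, integral_map hT.measurable.aemeasurable hm]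
  rw [Measure.volume_eq_prod] at hG hG' ⊢
  refine (integral_prod_symm _ hG').trans (integral_eq_zero_of_ae ?_)
  have hb : ∀ᵐ y : ℝ × ℝ, y.1 ≠ 0 :=
    Measure.quasiMeasurePreserving_fst.ae (Measure.ae_ne volume (0 : ℝ))
  filter_upwards [hb, hG.prod_left_ae, hG'.prod_left_ae] with y hy h1 h2
  exact integral_eq_zero_of_hasDerivAt_of_integrable (h y.1 hy y.2) h2 h1

lemma integral_eq_zero_of_hasDerivAt_X2 {F F' : ℝ × ℝ × ℝ → ℝ} (hF : Integrable F)
    (hF' : Integrable F')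
    (h : ∀ a ≠ 0, ∀ s b : ℝ, HasDerivAt (fun b => F (a, b, s + 1 / 2 * a * b))
      (F' (a, b, s + 1 / 2 * a * b)) b) :
    ∫ w, F' w = 0 := by
  have hT := measurePreserving_shear (1 / 2)
  have hm := hF'.1
  rw [← hT.map_eq] at hm
  have hG := hT.integrable_comp_of_integrable hF
  have hG' := hT.integrable_comp_of_integrable hF'
  rw [← hT.map_eq, integral_map hT.measurable.aemeasurable hm]
  rw [Measure.volume_eq_prod] at hG hG' ⊢
  refine (integral_prod _ hG').trans (integral_eq_zero_of_ae ?_)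
  filter_upwards [Measure.ae_ne volume (0 : ℝ), hG.prod_right_ae, hG'.prod_right_ae]
    with a ha h1 h2
  rw [Measure.volume_eq_prod] at h1 h2
  refine (integral_prod_symm _ h2).trans (integral_eq_zero_of_ae ?_)
  filter_upwards [h1.prod_left_ae, h2.prod_left_ae] with s h3 h4
  exact integral_eq_zero_of_hasDerivAt_of_integrable (h a ha s) h4 h3

lemma hasDerivAt_flux_along {q x : ℝ} {f g E : ℝ × ℝ × ℝ → ℝ} {γ : ℝ → ℝ × ℝ × ℝ}
    (hpos : 0 < kaplanFour (γ x))
    (hf : HasDerivAt (fun y => f (γ y)) (g (γ x)) x)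
    (hD : HasDerivAt (fun y => kaplanFour (γ y)) (E (γ x)) x)
    (hE : HasDerivAt (fun y => E (γ y)) (12 * horizSq (γ x)) x) :
    HasDerivAt (fun y => flux q f E (γ y)) (fluxDeriv q f g E (γ x)) x := by
  have h1 := hD.rpow_const (p := q) (Or.inl hpos.ne')
  have h2 := hD.rpow_const (p := q - 1) (Or.inl hpos.ne')
  refine (((hf.pow 2).mul h1.neg.exp).mul ((h2.const_mul q).mul hE)).congr_deriv ?_
  unfold fluxDeriv potentialDeriv potentialDerivTwo
  rw [show q - 1 - 1 = q - 2 by ring]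
  simp only [Pi.mul_apply, Pi.pow_apply, Pi.neg_apply]
  push_cast
  ring

lemma hasDerivAt_flux_X1 (q : ℝ) {f : ℝ × ℝ × ℝ → ℝ} (hf : Differentiable ℝ f) {b : ℝ}
    (hb : b ≠ 0) (s a : ℝ) :
    HasDerivAt (fun a => flux q f kaplanFourX1 (a, b, s + -1 / 2 * a * b))
      (fluxDeriv q f (X1 f) kaplanFourX1 (a, b, s + -1 / 2 * a * b)) a := by
  have ht : HasDerivAt (fun a : ℝ => s + -1 / 2 * a * b) (-b / 2) a := by
    refine ((((hasDerivAt_id a).const_mul (-1 / 2)).mul_const b).const_add s).congr_deriv ?_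
    ring
  have hr : HasDerivAt (fun a : ℝ => a ^ 2 + b ^ 2) (2 * a) a := by
    refine ((hasDerivAt_pow 2 a).add_const (b ^ 2)).congr_deriv ?_
    norm_num
  refine hasDerivAt_flux_along (γ := fun a => (a, b, s + -1 / 2 * a * b)) ?_ ?_ ?_ ?_
  · simp only [kaplanFour]; positivity
  · exact (hf _).hasFDerivAt.comp_hasDerivAt a
      ((hasDerivAt_id a).prodMk ((hasDerivAt_const a b).prodMk ht))
  · refine ((hr.pow 2).add ((ht.pow 2).const_mul 16)).congr_deriv ?_
    simp only [kaplanFourX1, horizSq]; push_cast; ring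
  · refine (((hr.const_mul 4).mul (hasDerivAt_id a)).sub
      ((ht.const_mul 16).mul_const b)).congr_deriv ?_
    simp only [horizSq, id]; ring

lemma hasDerivAt_flux_X2 (q : ℝ) {f : ℝ × ℝ × ℝ → ℝ} (hf : Differentiable ℝ f) {a : ℝ}
    (ha : a ≠ 0) (s b : ℝ) :
    HasDerivAt (fun b => flux q f kaplanFourX2 (a, b, s + 1 / 2 * a * b))
      (fluxDeriv q f (X2 f) kaplanFourX2 (a, b, s + 1 / 2 * a * b)) b := by
  have ht : HasDerivAt (fun b : ℝ => s + 1 / 2 * a * b) (a / 2) b := by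
    refine (((hasDerivAt_id b).const_mul (1 / 2 * a)).const_add s).congr_deriv ?_
    ring
  have hr : HasDerivAt (fun b : ℝ => a ^ 2 + b ^ 2) (2 * b) b := by
    refine ((hasDerivAt_pow 2 b).const_add (a ^ 2)).congr_deriv ?_
    norm_num
  refine hasDerivAt_flux_along (γ := fun b => (a, b, s + 1 / 2 * a * b)) ?_ ?_ ?_ ?_
  · simp only [kaplanFour]; positivity
  · exact (hf _).hasFDerivAt.comp_hasDerivAt b
      ((hasDerivAt_const b a).prodMk ((hasDerivAt_id b).prodMk ht))
  · refine ((hr.pow 2).add ((ht.pow 2).const_mul 16)).congr_deriv ?_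
    simp only [kaplanFourX2, horizSq]; push_cast; ring
  · refine (((hr.const_mul 4).mul (hasDerivAt_id b)).add
      ((ht.const_mul 16).mul_const a)).congr_deriv ?_
    simp only [horizSq, id]; ring

lemma exp_neg_kaplanFour_le_one (q : ℝ) (w : ℝ × ℝ × ℝ) :
    Real.exp (-kaplanFour w ^ q) ≤ 1 :=
  Real.exp_le_one_iff.2 (neg_nonpos.2 (Real.rpow_nonneg (kaplanFour_nonneg w) q))

lemma integrable_flux {q : ℝ} (hq : 1 / 2 < q) {f E : ℝ × ℝ × ℝ → ℝ} (hf : Continuous f)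
    (hc : HasCompactSupport f) (hE : Continuous E)
    (hEle : ∀ w, E w ^ 2 ≤ 16 * horizSq w * kaplanFour w) :
    Integrable (flux q f E) := by
  have hW : Continuous fun w => horizSq w * kaplanFour w ^ (2 * q - 1) :=
    continuous_horizSq.mul (continuous_kaplanFour.rpow_const fun _ => Or.inr (by linarith))
  have hbound : Integrable fun w =>
      f w * (f w * (1 + 16 * q ^ 2 * (horizSq w * kaplanFour w ^ (2 * q - 1)))) :=
    Continuous.integrable_of_hasCompactSupport (by fun_prop) hc.mul_right
  have hfm := hf.measurable
  have hEm := hE.measurable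
  have hDm := continuous_kaplanFour.measurable
  refine hbound.mono' (by unfold flux potentialDeriv; fun_prop) (.of_forall fun w => ?_)
  have hV := potentialDeriv_sq_le q (hEle w)
  have hV' : |potentialDeriv q E w| ≤
      1 + 16 * q ^ 2 * (horizSq w * kaplanFour w ^ (2 * q - 1)) := by
    nlinarith [sq_abs (potentialDeriv q E w), sq_nonneg (|potentialDeriv q E w| - 1),
      sq_nonneg (potentialDeriv q E w)]
  rw [flux, Real.norm_eq_abs, abs_mul, abs_mul, abs_of_nonneg (sq_nonneg (f w)), Real.abs_exp,
    ← mul_assoc, ← sq]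
  have h1 : f w ^ 2 * Real.exp (-kaplanFour w ^ q) ≤ f w ^ 2 :=
    mul_le_of_le_one_right (sq_nonneg _) (exp_neg_kaplanFour_le_one q w)
  exact mul_le_mul h1 hV' (abs_nonneg _) (sq_nonneg _)

lemma integrable_fluxDeriv {q : ℝ} (hq : 1 / 2 < q) {f g E : ℝ × ℝ × ℝ → ℝ}
    (hf : Continuous f) (hc : HasCompactSupport f) (hg : Continuous g)
    (hgc : HasCompactSupport g) (hE : Continuous E)
    (hEle : ∀ w, E w ^ 2 ≤ 16 * horizSq w * kaplanFour w) :
    Integrable (fluxDeriv q f g E) := by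
  have hW : Continuous fun w => horizSq w * kaplanFour w ^ (2 * q - 1) :=
    continuous_horizSq.mul (continuous_kaplanFour.rpow_const fun _ => Or.inr (by linarith))
  have hY : Continuous fun w => kaplanFour w ^ (q - 1 / 2) :=
    continuous_kaplanFour.rpow_const fun _ => Or.inr (by linarith)
  have hbound : Integrable fun w => g w * g w +
      f w * (f w * (2 * (16 * q ^ 2 * (horizSq w * kaplanFour w ^ (2 * q - 1))) +
        (12 * q + 16 * q * |q - 1|) * kaplanFour w ^ (q - 1 / 2))) :=
    (Continuous.integrable_of_hasCompactSupport (by fun_prop) hgc.mul_right).add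
      (Continuous.integrable_of_hasCompactSupport (by fun_prop) hc.mul_right)
  have hfm := hf.measurable
  have hgm := hg.measurable
  have hEm := hE.measurable
  have hDm := continuous_kaplanFour.measurable
  have hrm := continuous_horizSq.measurable
  refine hbound.mono' (by unfold fluxDeriv potentialDeriv potentialDerivTwo; fun_prop)
    (.of_forall fun w => ?_)
  have hV := potentialDeriv_sq_le q (hEle w)
  have hV' := abs_potentialDerivTwo_le (by linarith : 0 ≤ q) (hEle w)
  rw [fluxDeriv, Real.norm_eq_abs, abs_mul, Real.abs_exp]
  refine (mul_le_of_le_one_left (abs_nonneg _) (exp_neg_kaplanFour_le_one q w)).trans ?_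
  have h1 := mul_le_mul_of_nonneg_left hV (sq_nonneg (f w))
  have h2 := mul_le_mul_of_nonneg_left hV' (sq_nonneg (f w))
  have h3 := mul_le_mul_of_nonneg_left (le_abs_self (potentialDerivTwo q E w))
    (sq_nonneg (f w))
  have h4 := mul_le_mul_of_nonneg_left (neg_abs_le (potentialDerivTwo q E w))
    (sq_nonneg (f w))
  rw [abs_le]
  constructor
  · linarith [sq_nonneg (g w + f w * potentialDeriv q E w)]
  · linarith [sq_nonneg (g w - f w * potentialDeriv q E w),
      sq_nonneg (f w * potentialDeriv q E w)]

lemma continuous_X1 {f : ℝ × ℝ × ℝ → ℝ} (hf : ContDiff ℝ 1 f) : Continuous (X1 f) := by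
  have := hf.continuous_fderiv one_ne_zero
  unfold X1; fun_prop

lemma continuous_X2 {f : ℝ × ℝ × ℝ → ℝ} (hf : ContDiff ℝ 1 f) : Continuous (X2 f) := by
  have := hf.continuous_fderiv one_ne_zero
  unfold X2; fun_prop

lemma hasCompactSupport_X1 {f : ℝ × ℝ × ℝ → ℝ} (hf : HasCompactSupport f) :
    HasCompactSupport (X1 f) :=
  (hf.fderiv ℝ).mono fun w hw h => hw (by simp [X1, h])

lemma hasCompactSupport_X2 {f : ℝ × ℝ × ℝ → ℝ} (hf : HasCompactSupport f) :
    HasCompactSupport (X2 f) :=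
  (hf.fderiv ℝ).mono fun w hw h => hw (by simp [X2, h])

lemma integral_muH (p : ℝ) (g : ℝ × ℝ × ℝ → ℝ) :
    ∫ w, g w ∂(muH p) = (∫ v : ℝ × ℝ × ℝ, Real.exp (-(KaplanH v) ^ p))⁻¹ *
      ∫ w, Real.exp (-kaplanFour w ^ (p / 4)) * g w := by
  have hc : 0 ≤ (∫ v : ℝ × ℝ × ℝ, Real.exp (-(KaplanH v) ^ p))⁻¹ :=
    inv_nonneg.2 (integral_nonneg fun _ => (Real.exp_pos _).le)
  have hDm := continuous_kaplanFour.measurable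
  simp only [muH, kaplanH_rpow] at hc ⊢
  rw [integral_withDensity_eq_integral_toReal_smul (by fun_prop)
    (.of_forall fun _ => ENNReal.ofReal_lt_top), ← integral_const_mul]
  refine integral_congr_ae (.of_forall fun w => ?_)
  simp only [smul_eq_mul]
  rw [ENNReal.toReal_ofReal (mul_nonneg hc (Real.exp_pos _).le), mul_assoc]

/-- The `U`-bound with respect to the unnormalised density `e^{-U}`, `U = (N⁴)^q`. -/
lemma exists_ubound_lebesgue {q : ℝ} (hq : 1 / 2 < q) :
    ∃ C > 0, ∀ f : ℝ × ℝ × ℝ → ℝ, ContDiff ℝ 1 f → HasCompactSupport f →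
      ∫ w, Real.exp (-kaplanFour w ^ q) *
          (horizSq w * kaplanFour w ^ (2 * q - 1) * f w ^ 2) ≤
        C * ((∫ w, Real.exp (-kaplanFour w ^ q) * (X1 f w ^ 2 + X2 f w ^ 2)) +
          ∫ w, Real.exp (-kaplanFour w ^ q) * f w ^ 2) := by
  obtain ⟨K, hK, hKle⟩ := exists_laplacian_le hq
  have hq0 : 0 < q := by linarith
  refine ⟨(2 + K) / (4 * q ^ 2), by positivity, fun f hf hc => ?_⟩
  have hfc := hf.continuous
  have h1c := continuous_X1 hf
  have h2c := continuous_X2 hf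
  have h1s := hasCompactSupport_X1 hc
  have h2s := hasCompactSupport_X2 hc
  have hle1 : ∀ w, kaplanFourX1 w ^ 2 ≤ 16 * horizSq w * kaplanFour w := fun w => by
    linarith [kaplanFourX1_sq_add_X2_sq w, sq_nonneg (kaplanFourX2 w)]
  have hle2 : ∀ w, kaplanFourX2 w ^ 2 ≤ 16 * horizSq w * kaplanFour w := fun w => by
    linarith [kaplanFourX1_sq_add_X2_sq w, sq_nonneg (kaplanFourX1 w)]
  have hi1 := integrable_fluxDeriv hq hfc hc h1c h1s continuous_kaplanFourX1 hle1
  have hi2 := integrable_fluxDeriv hq hfc hc h2c h2s continuous_kaplanFourX2 hle2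
  have hdiff := hf.differentiable one_ne_zero
  have hz1 : ∫ w, fluxDeriv q f (X1 f) kaplanFourX1 w = 0 :=
    integral_eq_zero_of_hasDerivAt_X1
      (integrable_flux hq hfc hc continuous_kaplanFourX1 hle1) hi1
      fun _ hb s a => hasDerivAt_flux_X1 q hdiff hb s a
  have hz2 : ∫ w, fluxDeriv q f (X2 f) kaplanFourX2 w = 0 :=
    integral_eq_zero_of_hasDerivAt_X2
      (integrable_flux hq hfc hc continuous_kaplanFourX2 hle2) hi2
      fun _ ha s b => hasDerivAt_flux_X2 q hdiff ha s b
  have hexp : Continuous fun w => Real.exp (-kaplanFour w ^ q) :=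
    Real.continuous_exp.comp
      (continuous_kaplanFour.rpow_const fun _ => Or.inr hq0.le).neg
  have hW : Continuous fun w => horizSq w * kaplanFour w ^ (2 * q - 1) :=
    continuous_horizSq.mul (continuous_kaplanFour.rpow_const fun _ => Or.inr (by linarith))
  have hf2 : HasCompactSupport fun w => f w ^ 2 := by
    simp only [sq]; exact hc.mul_right
  have hg2 : HasCompactSupport fun w => X1 f w ^ 2 + X2 f w ^ 2 := by
    simp only [sq]; exact h1s.mul_right.add h2s.mul_right
  have hiW : Integrable fun w => Real.exp (-kaplanFour w ^ q) *
      (horizSq w * kaplanFour w ^ (2 * q - 1) * f w ^ 2) :=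
    Continuous.integrable_of_hasCompactSupport (by fun_prop) hf2.mul_left.mul_left
  have hig : Integrable fun w => Real.exp (-kaplanFour w ^ q) * (X1 f w ^ 2 + X2 f w ^ 2) :=
    Continuous.integrable_of_hasCompactSupport (by fun_prop) hg2.mul_left
  have hif : Integrable fun w => Real.exp (-kaplanFour w ^ q) * f w ^ 2 :=
    Continuous.integrable_of_hasCompactSupport (by fun_prop) hf2.mul_left
  have hpt : ∀ w, 4 * q ^ 2 * (Real.exp (-kaplanFour w ^ q) *
        (horizSq w * kaplanFour w ^ (2 * q - 1) * f w ^ 2)) +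
        (fluxDeriv q f (X1 f) kaplanFourX1 w + fluxDeriv q f (X2 f) kaplanFourX2 w) ≤
      2 * (Real.exp (-kaplanFour w ^ q) * (X1 f w ^ 2 + X2 f w ^ 2)) +
        K * (Real.exp (-kaplanFour w ^ q) * f w ^ 2) := fun w => by
    have hV := congrArg (f w ^ 2 * ·) (potentialDeriv_sq_add q w)
    have hV2 := congrArg (f w ^ 2 * ·) (potentialDerivTwo_add q w)
    have hKw := mul_le_mul_of_nonneg_left (hKle w) (sq_nonneg (f w))
    have key : 4 * q ^ 2 * (horizSq w * kaplanFour w ^ (2 * q - 1) * f w ^ 2) +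
        ((2 * f w * X1 f w * potentialDeriv q kaplanFourX1 w -
            f w ^ 2 * potentialDeriv q kaplanFourX1 w ^ 2 +
            f w ^ 2 * potentialDerivTwo q kaplanFourX1 w) +
          (2 * f w * X2 f w * potentialDeriv q kaplanFourX2 w -
            f w ^ 2 * potentialDeriv q kaplanFourX2 w ^ 2 +
            f w ^ 2 * potentialDerivTwo q kaplanFourX2 w)) ≤
        2 * (X1 f w ^ 2 + X2 f w ^ 2) + K * f w ^ 2 := by
      linarith [sq_nonneg (2 * X1 f w - f w * potentialDeriv q kaplanFourX1 w),
        sq_nonneg (2 * X2 f w - f w * potentialDeriv q kaplanFourX2 w)]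
    have := mul_le_mul_of_nonneg_left key (Real.exp_pos (-kaplanFour w ^ q)).le
    unfold fluxDeriv
    linarith
  have hint := integral_mono ((hiW.const_mul (4 * q ^ 2)).add (hi1.add hi2))
    ((hig.const_mul 2).add (hif.const_mul K)) hpt
  rw [integral_add' (hiW.const_mul _) (hi1.add hi2), integral_add' (hig.const_mul _)
    (hif.const_mul _), integral_add' hi1 hi2, hz1, hz2, integral_const_mul,
    integral_const_mul, integral_const_mul] at hint
  have hg0 : 0 ≤ ∫ w, Real.exp (-kaplanFour w ^ q) * (X1 f w ^ 2 + X2 f w ^ 2) :=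
    integral_nonneg fun w => by positivity
  have hf0 : 0 ≤ ∫ w, Real.exp (-kaplanFour w ^ q) * f w ^ 2 :=
    integral_nonneg fun w => by positivity
  rw [div_mul_eq_mul_div, le_div_iff₀ (by positivity)]
  nlinarith [mul_nonneg hK hg0]

/-- `U`-bound on the Heisenberg group for `dμ = Z⁻¹ e^{-N^p} dξ`, `p > 2`:
`∫ |x|² N^{2(p-2)} f² dμ ≤ C(∫ |∇_ℍ f|² dμ + ∫ f² dμ)`. -/
theorem ubound_L2_heisenberg (p : ℝ) (hp : 2 < p) :
    ∃ C > 0, ∀ f : ℝ × ℝ × ℝ → ℝ, ContDiff ℝ (⊤ : ℕ∞) f → HasCompactSupport f →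
      ∫ w, (w.1 ^ 2 + w.2.1 ^ 2) * (KaplanH w) ^ (2 * (p - 2)) * (f w) ^ 2 ∂(muH p) ≤
        C * ((∫ w, (X1 f w) ^ 2 + (X2 f w) ^ 2 ∂(muH p)) +
             (∫ w, (f w) ^ 2 ∂(muH p))) := by
  obtain ⟨C, hC, hbound⟩ := exists_ubound_lebesgue (q := p / 4) (by linarith)
  refine ⟨C, hC, fun f hf hc => ?_⟩
  have hZ : 0 ≤ (∫ v : ℝ × ℝ × ℝ, Real.exp (-(KaplanH v) ^ p))⁻¹ :=
    inv_nonneg.2 (integral_nonneg fun _ => (Real.exp_pos _).le)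
  rw [integral_muH, integral_muH, integral_muH, ← mul_add, mul_left_comm C]
  refine mul_le_mul_of_nonneg_left ?_ hZ
  refine le_trans (le_of_eq ?_) (hbound f (hf.of_le (by exact_mod_cast le_top)) hc)
  refine integral_congr_ae (.of_forall fun w => ?_)
  simp only [kaplanH_rpow, horizSq]
  rw [show 2 * (p - 2) / 4 = 2 * (p / 4) - 1 by ring]
end
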